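/- arXiv:1805.11635 — 2 statements merged into one kernel-verified Lean document; each statement's English description precedes it below -/
import Mathlib

section
/- Let A be a complex Banach algebra and X a contractive right Banach A-module. Then (F_q(A*)*, η_q), with predual F_q(A*) and the first Arens product ◻, is an HLDBA over A, and the map Γ̆_q : F_q(A*)* → B(X*), Γ̆_q(μ)(x*) = μ·x*, is a contractive algebra homomorphism, continuous from the weak* topology of F_q(A*)* to the weak* topology of B(X*), with Γ̆_q∘η_q = Γ_q. Moreover it is minimal with this property: if (𝔄, η) is any HLDBA over A and Γ : 𝔄 → B(X*) is a contractive algebra homomorphism, continuous from the weak* topology of 𝔄 to the weak* topology of B(X*), with Γ∘η = Γ_q, then there exists a weak*-continuous linear contraction Φ : 𝔄 → F_q(A*)* with Φ∘η = η_q. -/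
open scoped Topology
open Filter

noncomputable section

/-- The right dual action of `A` on `A*`: `(φ · a) b = φ (a * b)`. -/
def dAct {A : Type*} [NonUnitalNormedRing A] [NormedSpace ℂ A]
    [IsScalarTower ℂ A A] [SMulCommClass ℂ A A]
    (φ : A →L[ℂ] ℂ) (a : A) : A →L[ℂ] ℂ :=
  φ.comp (ContinuousLinearMap.mul ℂ A a)

/-- The canonical map `η : A → S*`, `⟨η a, φ⟩ = ⟨ι φ, a⟩`. -/
def etaMap {A : Type*} [NonUnitalNormedRing A] [NormedSpace ℂ A]
    [IsScalarTower ℂ A A] [SMulCommClass ℂ A A]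
    {S : Type*} [NormedAddCommGroup S] [NormedSpace ℂ S]
    (ι : S →ₗ[ℂ] (A →L[ℂ] ℂ)) (hι : ∀ φ : S, ‖ι φ‖ ≤ ‖φ‖) (a : A) : S →L[ℂ] ℂ :=
  LinearMap.mkContinuous
    { toFun := fun φ => ι φ a
      map_add' := fun φ ψ => by simp
      map_smul' := fun c φ => by simp }
    ‖a‖
    (fun φ => by
      have h1 : ‖ι φ a‖ ≤ ‖ι φ‖ * ‖a‖ := (ι φ).le_opNorm a
      have h2 : ‖ι φ‖ * ‖a‖ ≤ ‖φ‖ * ‖a‖ :=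
        mul_le_mul_of_nonneg_right (hι φ) (norm_nonneg a)
      calc ‖ι φ a‖ ≤ ‖φ‖ * ‖a‖ := h1.trans h2
        _ = ‖a‖ * ‖φ‖ := mul_comm _ _)

/-- The "identity" map from the normed dual to the weak-star dual. -/
def toW {S : Type*} [NormedAddCommGroup S] [NormedSpace ℂ S] (μ : S →L[ℂ] ℂ) :
    WeakDual ℂ S := StrongDual.toWeakDual μ

/-- The "identity" map from the weak-star dual to the normed dual. -/
def ofW {S : Type*} [NormedAddCommGroup S] [NormedSpace ℂ S] (μ : WeakDual ℂ S) :
    S →L[ℂ] ℂ := WeakDual.toStrongDual μ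

/-- coefficient functional `x* · x` of a module action: `(x* · x) a = x* (x · a)`. -/
def coeffFn {A : Type*} [NonUnitalNormedRing A] [NormedSpace ℂ A]
    [IsScalarTower ℂ A A] [SMulCommClass ℂ A A]
    {X : Type*} [NormedAddCommGroup X] [NormedSpace ℂ X]
    (m : X →L[ℂ] A →L[ℂ] X) (xs : X →L[ℂ] ℂ) (x : X) : A →L[ℂ] ℂ :=
  xs.comp (m x)

/-- Membership in the Fourier space `F_q(A*)`. -/
def FqMem {A : Type*} [NonUnitalNormedRing A] [NormedSpace ℂ A]
    [IsScalarTower ℂ A A] [SMulCommClass ℂ A A]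
    {X : Type*} [NormedAddCommGroup X] [NormedSpace ℂ X]
    (m : X →L[ℂ] A →L[ℂ] X) (φ : A →L[ℂ] ℂ) : Prop :=
  ∃ (xs : ℕ → (X →L[ℂ] ℂ)) (x : ℕ → X),
    (Summable fun n => ‖xs n‖ * ‖x n‖) ∧
    ∀ a : A, HasSum (fun n => xs n (m (x n) a)) (φ a)

/-- The Fourier norm `‖·‖_q`. -/
def qNorm {A : Type*} [NonUnitalNormedRing A] [NormedSpace ℂ A]
    [IsScalarTower ℂ A A] [SMulCommClass ℂ A A]
    {X : Type*} [NormedAddCommGroup X] [NormedSpace ℂ X]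
    (m : X →L[ℂ] A →L[ℂ] X) (φ : A →L[ℂ] ℂ) : ℝ :=
  sInf { c : ℝ | ∃ (xs : ℕ → (X →L[ℂ] ℂ)) (x : ℕ → X),
    (Summable fun n => ‖xs n‖ * ‖x n‖) ∧
    (∀ a : A, HasSum (fun n => xs n (m (x n) a)) (φ a)) ∧
    c = ∑' n, ‖xs n‖ * ‖x n‖ }

/-- The weak-star topology on `B(X*)` via its identification with `(X* ⊗ X)*`:
the coarsest topology making `T ↦ Σₙ ⟨T xₙ*, xₙ⟩` continuous for all absolutely
summable sequences. -/
def wstarT (X : Type*) [NormedAddCommGroup X] [NormedSpace ℂ X] :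
    TopologicalSpace ((X →L[ℂ] ℂ) →L[ℂ] (X →L[ℂ] ℂ)) :=
  ⨅ (p : (ℕ → (X →L[ℂ] ℂ)) × (ℕ → X)) (_ : Summable fun n => ‖p.1 n‖ * ‖p.2 n‖),
    TopologicalSpace.induced (fun T => ∑' n, T (p.1 n) (p.2 n)) inferInstance

/-- `Γ_q : A → B(X*)`, `Γ_q(a)(x*) = a · x*`, i.e. `Γ_q(a)(x*)(x) = x*(x · a)`. -/
def GammaQ {A : Type*} [NonUnitalNormedRing A] [NormedSpace ℂ A]
    [IsScalarTower ℂ A A] [SMulCommClass ℂ A A]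
    {X : Type*} [NormedAddCommGroup X] [NormedSpace ℂ X]
    (m : X →L[ℂ] A →L[ℂ] X) (a : A) : (X →L[ℂ] ℂ) →L[ℂ] (X →L[ℂ] ℂ) :=
  (ContinuousLinearMap.compL ℂ X X ℂ).flip (m.flip a)

/-- `M_q`: the weak-star closure of `Γ_q(A)` in `B(X*)`. -/
def Mq {A : Type*} [NonUnitalNormedRing A] [NormedSpace ℂ A]
    [IsScalarTower ℂ A A] [SMulCommClass ℂ A A]
    {X : Type*} [NormedAddCommGroup X] [NormedSpace ℂ X]
    (m : X →L[ℂ] A →L[ℂ] X) : Set ((X →L[ℂ] ℂ) →L[ℂ] (X →L[ℂ] ℂ)) :=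
  @closure _ (wstarT X) (Set.range fun a : A => GammaQ m a)

theorem toW_apply' {S : Type*} [NormedAddCommGroup S] [NormedSpace ℂ S] (μ : S →L[ℂ] ℂ) (s : S) :
    toW μ s = μ s := rfl

theorem ofW_apply' {S : Type*} [NormedAddCommGroup S] [NormedSpace ℂ S] (μ : WeakDual ℂ S)
    (s : S) : ofW μ s = μ s := rfl

/-- A subspace that separates points is dense in the weak topology of a pairing. -/
theorem weakBilin_dense {E F : Type*} [AddCommGroup E] [Module ℂ E] [Module ℝ E]
    [IsScalarTower ℝ ℂ E] [AddCommGroup F] [Module ℂ F] (B : E →ₗ[ℂ] F →ₗ[ℂ] ℂ)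
    (W : Submodule ℂ (WeakBilin B)) (hW : ∀ s : F, (∀ w ∈ W, B w s = 0) → s = 0) :
    Dense (W : Set (WeakBilin B)) := by
  have := IsScalarTower.continuousSMul (M := ℝ) (α := WeakBilin B) ℂ
  intro μ
  by_contra hμ
  obtain ⟨f, u, hf, hu⟩ := RCLike.geometric_hahn_banach_closed_point (𝕜 := ℂ)
    (s := closure (W : Set (WeakBilin B))) (x := μ)
    ((W.restrictScalars ℝ).convex.closure) isClosed_closure hμ
  obtain ⟨s, hs⟩ := LinearMap.dualEmbedding_surjective B f
  have hfs : ∀ w : WeakBilin B, f w = B w s := fun w => by rw [← hs]; rfl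
  have h0 : ∀ w ∈ W, B w s = 0 := by
    intro w hw
    by_contra hne
    have := hf _ (subset_closure (W.smul_mem (((|u| + 1 : ℝ) : ℂ) / B w s) hw))
    rw [map_smul, hfs, smul_eq_mul, div_mul_cancel₀ _ hne] at this
    simp only [RCLike.re_to_complex, Complex.ofReal_re] at this
    linarith [le_abs_self u]
  have hs0 := hW s h0
  have h1 := hf 0 (subset_closure W.zero_mem)
  rw [hfs, hs0, map_zero] at hu
  rw [map_zero] at h1
  exact lt_asymm h1 hu

/-- A subspace of the dual that separates points is weak-star dense. -/
theorem weakDual_dense {S : Type*} [NormedAddCommGroup S] [NormedSpace ℂ S]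
    (W : Submodule ℂ (WeakDual ℂ S)) (hW : ∀ s : S, (∀ w ∈ W, w s = 0) → s = 0) :
    Dense (W : Set (WeakDual ℂ S)) :=
  weakBilin_dense (topDualPairing ℂ S) W hW

theorem coeff_map
    {A : Type*} [NonUnitalNormedRing A] [NormedSpace ℂ A]
    [IsScalarTower ℂ A A] [SMulCommClass ℂ A A]
    {X : Type*} [NormedAddCommGroup X] [NormedSpace ℂ X]
    (m : X →L[ℂ] A →L[ℂ] X)
    {S : Type*} [NormedAddCommGroup S] [NormedSpace ℂ S]
    (ιS : S →ₗ[ℂ] (A →L[ℂ] ℂ)) (hinj : Function.Injective ιS)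
    (hrange : ∀ φ, FqMem m φ ↔ φ ∈ Set.range ιS)
    (hnormS : ∀ s : S, ‖s‖ = qNorm m (ιS s)) :
    ∃ c : (X →L[ℂ] ℂ) →L[ℂ] X →L[ℂ] S, (∀ xs x a, ιS (c xs x) a = xs (m x a)) ∧
      ∀ xs x, ‖c xs x‖ ≤ ‖xs‖ * ‖x‖ := by
  have hrep : ∀ (xs : X →L[ℂ] ℂ) (x : X),
      (HasSum (fun n : ℕ => ‖(if n = 0 then xs else 0 : X →L[ℂ] ℂ)‖ * ‖x‖) (‖xs‖ * ‖x‖)) ∧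
      ∀ a : A, HasSum (fun n : ℕ => (if n = 0 then xs else 0 : X →L[ℂ] ℂ) (m x a))
        (coeffFn m xs x a) := by
    intro xs x
    constructor
    · convert hasSum_ite_eq (0 : ℕ) (‖xs‖ * ‖x‖) using 2 with n
      split_ifs <;> simp
    · intro a
      convert hasSum_ite_eq (0 : ℕ) (xs (m x a)) using 2 with n
      · split_ifs <;> simp
      · rfl
  have hex : ∀ (xs : X →L[ℂ] ℂ) (x : X), ∃ s, ιS s = coeffFn m xs x := by
    intro xs x
    exact (hrange _).1 ⟨_, fun _ => x, (hrep xs x).1.summable, (hrep xs x).2⟩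
  choose c hc using hex
  have hn : ∀ xs x, ‖c xs x‖ ≤ ‖xs‖ * ‖x‖ := by
    intro xs x
    rw [hnormS, hc]
    refine csInf_le ⟨0, ?_⟩ ⟨_, fun _ => x, (hrep xs x).1.summable, (hrep xs x).2,
      (hrep xs x).1.tsum_eq.symm⟩
    rintro _ ⟨_, _, _, _, rfl⟩
    exact tsum_nonneg fun n => by positivity
  refine ⟨LinearMap.mkContinuous₂ (LinearMap.mk₂ ℂ c ?_ ?_ ?_ ?_) 1 ?_, ?_, ?_⟩
  · intro x y z; apply hinj; rw [map_add, hc, hc, hc]; ext a; simp [coeffFn]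
  · intro x y z; apply hinj; rw [map_smul, hc, hc]; ext a; simp [coeffFn]
  · intro x y z; apply hinj; rw [map_add, hc, hc, hc]; ext a; simp [coeffFn]
  · intro x y z; apply hinj; rw [map_smul, hc, hc]; ext a; simp [coeffFn]
  · intro xs x; simpa using hn xs x
  · intro xs x a
    simp [hc, coeffFn]
  · intro xs x
    simpa using hn xs x

theorem exists_rep
    {A : Type*} [NonUnitalNormedRing A] [NormedSpace ℂ A]
    [IsScalarTower ℂ A A] [SMulCommClass ℂ A A]
    {X : Type*} [NormedAddCommGroup X] [NormedSpace ℂ X]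
    (m : X →L[ℂ] A →L[ℂ] X)
    {S : Type*} [NormedAddCommGroup S] [NormedSpace ℂ S]
    (ιS : S →ₗ[ℂ] (A →L[ℂ] ℂ))
    (hrange : ∀ φ, FqMem m φ ↔ φ ∈ Set.range ιS)
    (hnormS : ∀ s : S, ‖s‖ = qNorm m (ιS s)) (s : S) (ε : ℝ) (hε : 0 < ε) :
    ∃ (xs : ℕ → (X →L[ℂ] ℂ)) (x : ℕ → X), (Summable fun n => ‖xs n‖ * ‖x n‖) ∧
    (∀ a : A, HasSum (fun n => xs n (m (x n) a)) (ιS s a)) ∧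
    ∑' n, ‖xs n‖ * ‖x n‖ < ‖s‖ + ε := by
  obtain ⟨xs, x, h1, h2⟩ := (hrange (ιS s)).2 ⟨s, rfl⟩
  have hlt : qNorm m (ιS s) < ‖s‖ + ε := by rw [← hnormS]; linarith
  unfold qNorm at hlt
  obtain ⟨_, ⟨ys, y, h3, h4, rfl⟩, h5⟩ :=
    exists_lt_of_csInf_lt (by exact ⟨_, xs, x, h1, h2, rfl⟩) hlt
  exact ⟨ys, y, h3, h4, h5⟩

theorem summable_apply {X : Type*} [NormedAddCommGroup X] [NormedSpace ℂ X]
    (T : (X →L[ℂ] ℂ) →L[ℂ] (X →L[ℂ] ℂ)) (xs : ℕ → (X →L[ℂ] ℂ)) (x : ℕ → X)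
    (h : Summable fun n => ‖xs n‖ * ‖x n‖) :
    (Summable fun n => T (xs n) (x n)) ∧
      ‖∑' n, T (xs n) (x n)‖ ≤ ‖T‖ * ∑' n, ‖xs n‖ * ‖x n‖ := by
  have hb : ∀ n, ‖T (xs n) (x n)‖ ≤ ‖T‖ * (‖xs n‖ * ‖x n‖) := fun n => by
    rw [← mul_assoc]; exact T.le_opNorm₂ _ _
  refine ⟨Summable.of_norm_bounded (h.mul_left _) hb, ?_⟩
  exact tsum_of_norm_bounded (h.hasSum.mul_left _) hb

theorem wstar_eval {X : Type*} [NormedAddCommGroup X] [NormedSpace ℂ X]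
    (xs : ℕ → (X →L[ℂ] ℂ)) (x : ℕ → X)
    (h : Summable fun n => ‖xs n‖ * ‖x n‖) :
    @Continuous _ _ (wstarT X) _
      (fun T : (X →L[ℂ] ℂ) →L[ℂ] (X →L[ℂ] ℂ) => ∑' n, T (xs n) (x n)) := by
  unfold wstarT
  exact continuous_iInf_dom (i := (xs, x)) (continuous_iInf_dom (i := h) continuous_induced_dom)

/-- `(F_q(A*)*, η_q)` (realized on `S`) is an HLDBA over `A`:
with the first Arens product `◻` (characterized via `box`), multiplication is
weak-star continuous in the left variable, `η_q` is a contractive homomorphism with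
weak-star dense range mapping into the topological centre; the map
`Γ̆_q : F_q(A*)* → B(X*)` is a contractive weak-star–weak-star continuous algebra
homomorphism with `Γ̆_q ∘ η_q = Γ_q`.  Moreover it is minimal: every HLDBA `(B, η')`
over `A` (with predual `P`, identified via `j`) admitting a contractive weak-star
continuous representation `Γ : B → B(X*)` with `Γ ∘ η' = Γ_q` dominates it:
there is a weak-star continuous linear contraction `Φ : B → F_q(A*)*` with
`Φ ∘ η' = η_q`. -/
theorem statement_9
    {A : Type*} [NonUnitalNormedRing A] [NormedSpace ℂ A] [CompleteSpace A]
    [IsScalarTower ℂ A A] [SMulCommClass ℂ A A]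
    {X : Type*} [NormedAddCommGroup X] [NormedSpace ℂ X] [CompleteSpace X]
    (m : X →L[ℂ] A →L[ℂ] X)
    (hmn : ∀ (x : X) (a : A), ‖m x a‖ ≤ ‖x‖ * ‖a‖)
    (hma : ∀ (x : X) (a b : A), m (m x a) b = m x (a * b))
    {S : Type*} [NormedAddCommGroup S] [NormedSpace ℂ S] [CompleteSpace S]
    (ιS : S →ₗ[ℂ] (A →L[ℂ] ℂ)) (hinj : Function.Injective ιS)
    (hrange : ∀ φ, FqMem m φ ↔ φ ∈ Set.range ιS)
    (hnormS : ∀ s : S, ‖s‖ = qNorm m (ιS s))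
    (hcontrS : ∀ s : S, ‖ιS s‖ ≤ ‖s‖)
    (hactS : ∀ (s : S) (a : A), ∃ u : S, ιS u = dAct (ιS s) a)
    (box : (S →L[ℂ] ℂ) → S → S)
    (hbox : ∀ (ν : S →L[ℂ] ℂ) (s : S) (a : A) (u : S),
      ιS u = dAct (ιS s) a → ιS (box ν s) a = ν u) :
    -- `(F_q(A*)*, η_q)` is an HLDBA over `A`
    (∀ ar : (S →L[ℂ] ℂ) → (S →L[ℂ] ℂ) → (S →L[ℂ] ℂ),
      (∀ μ ν s, ar μ ν s = μ (box ν s)) →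
      (∀ ν, Continuous fun μ : WeakDual ℂ S => toW (ar (ofW μ) ν)) ∧
      (∀ a b : A, etaMap ιS hcontrS (a + b) = etaMap ιS hcontrS a + etaMap ιS hcontrS b) ∧
      (∀ (c : ℂ) (a : A), etaMap ιS hcontrS (c • a) = c • etaMap ιS hcontrS a) ∧
      (∀ a b : A, etaMap ιS hcontrS (a * b) =
        ar (etaMap ιS hcontrS a) (etaMap ιS hcontrS b)) ∧
      (∀ a : A, ‖etaMap ιS hcontrS a‖ ≤ ‖a‖) ∧
      DenseRange (fun a : A => toW (etaMap ιS hcontrS a)) ∧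
      (∀ a : A, Continuous fun ν : WeakDual ℂ S =>
        toW (ar (etaMap ιS hcontrS a) (ofW ν))) ∧
      -- the representation `Γ̆_q`
      (∃ Γb : (S →L[ℂ] ℂ) →ₗ[ℂ] ((X →L[ℂ] ℂ) →L[ℂ] (X →L[ℂ] ℂ)),
        (∀ (μ : S →L[ℂ] ℂ) (xs : X →L[ℂ] ℂ) (x : X) (s : S),
          ιS s = coeffFn m xs x → Γb μ xs x = μ s) ∧
        (∀ μ, ‖Γb μ‖ ≤ ‖μ‖) ∧
        (∀ μ ν, Γb (ar μ ν) = (Γb μ).comp (Γb ν)) ∧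
        (@Continuous (WeakDual ℂ S) _ _ (wstarT X) (fun μ => Γb (ofW μ))) ∧
        (∀ a : A, Γb (etaMap ιS hcontrS a) = GammaQ m a))) ∧
    -- minimality among HLDBAs over `A` representable on `X*` extending `Γ_q`
    (∀ (B P : Type*) (_ : NonUnitalNormedRing B) (_ : NormedSpace ℂ B)
      (_ : CompleteSpace B) (_ : IsScalarTower ℂ B B) (_ : SMulCommClass ℂ B B)
      (_ : NormedAddCommGroup P) (_ : NormedSpace ℂ P) (_ : CompleteSpace P)
      (j : B ≃ₗᵢ[ℂ] (P →L[ℂ] ℂ))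
      (η' : A → B),
      (∀ ν : B, Continuous fun μ : WeakDual ℂ P => toW (j (j.symm (ofW μ) * ν))) →
      (∀ a b, η' (a + b) = η' a + η' b) →
      (∀ (c : ℂ) a, η' (c • a) = c • η' a) →
      (∀ a b, η' (a * b) = η' a * η' b) →
      (∀ a, ‖η' a‖ ≤ ‖a‖) →
      (∀ a : A, Continuous fun ν : WeakDual ℂ P => toW (j (η' a * j.symm (ofW ν)))) →
      (DenseRange fun a : A => toW (j (η' a))) →
      ∀ Γ : B →ₗ[ℂ] ((X →L[ℂ] ℂ) →L[ℂ] (X →L[ℂ] ℂ)),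
      (∀ b, ‖Γ b‖ ≤ ‖b‖) →
      (∀ b b', Γ (b * b') = (Γ b).comp (Γ b')) →
      (@Continuous (WeakDual ℂ P) _ _ (wstarT X) (fun μ => Γ (j.symm (ofW μ)))) →
      (∀ a : A, Γ (η' a) = GammaQ m a) →
      ∃ Φ : B →ₗ[ℂ] (S →L[ℂ] ℂ),
        (∀ b, ‖Φ b‖ ≤ ‖b‖) ∧
        Continuous (fun μ : WeakDual ℂ P => toW (Φ (j.symm (ofW μ)))) ∧
        (∀ a : A, Φ (η' a) = etaMap ιS hcontrS a)) := by
  obtain ⟨c, hc, hcn⟩ := coeff_map m ιS hinj hrange hnormS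
  have heta : ∀ a s, etaMap ιS hcontrS a s = ιS s a := fun a s => rfl
  constructor
  · intro ar har
    have hadd : ∀ a b : A,
        etaMap ιS hcontrS (a + b) = etaMap ιS hcontrS a + etaMap ιS hcontrS b := by
      intro a b; ext s; simp [heta]
    have hsmul : ∀ (k : ℂ) (a : A), etaMap ιS hcontrS (k • a) = k • etaMap ιS hcontrS a := by
      intro a b; ext s; simp [heta]
    refine ⟨?_, hadd, hsmul, ?_, ?_, ?_, ?_, ?_⟩
    · intro ν
      refine WeakDual.continuous_of_continuous_eval fun s => ?_
      simp only [toW_apply', har, ofW_apply']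
      exact WeakDual.eval_continuous _
    · intro a b
      ext s
      obtain ⟨u, hu⟩ := hactS s a
      rw [har, heta, heta, hbox _ _ _ _ hu, heta, hu]
      rfl
    · intro a
      exact LinearMap.mkContinuous_norm_le _ (norm_nonneg a) _
    · have := weakDual_dense (LinearMap.range
        ({ toFun := fun a => toW (etaMap ιS hcontrS a)
           map_add' := fun a b => by rw [hadd]; rfl
           map_smul' := fun k a => by rw [hsmul]; rfl } : A →ₗ[ℂ] WeakDual ℂ S)) (by
          intro s hs
          apply hinj
          rw [map_zero]
          ext a
          exact hs _ ⟨a, rfl⟩)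
      rwa [LinearMap.coe_range] at this
    · intro a
      refine WeakDual.continuous_of_continuous_eval fun s => ?_
      obtain ⟨u, hu⟩ := hactS s a
      have : ∀ ν : WeakDual ℂ S, (toW (ar (etaMap ιS hcontrS a) (ofW ν))) s = ν u := fun ν => by
        rw [toW_apply', har, heta, hbox _ _ _ _ hu, ofW_apply']
      simp only [this]
      exact WeakDual.eval_continuous _
    · have hcu : ∀ xs x s, ιS s = coeffFn m xs x → s = c xs x := by
        intro xs x s hs
        apply hinj
        rw [hs]
        ext a
        rw [hc]
        rfl
      refine ⟨{ toFun := fun μ => (ContinuousLinearMap.compL ℂ X S ℂ μ).comp c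
                map_add' := fun μ ν => by ext; simp
                map_smul' := fun k μ => by ext; simp }, ?_, ?_, ?_, ?_, ?_⟩
      · intro μ xs x s hs
        rw [hcu _ _ _ hs]
        rfl
      · intro μ
        refine ContinuousLinearMap.opNorm_le_bound₂ _ (norm_nonneg _) fun xs x => ?_
        calc ‖μ (c xs x)‖ ≤ ‖μ‖ * ‖c xs x‖ := μ.le_opNorm _
          _ ≤ ‖μ‖ * (‖xs‖ * ‖x‖) := by gcongr; exact hcn _ _
          _ = _ := by ring
      · intro μ ν
        ext xs x
        change ar μ ν (c xs x) = μ (c (ν.comp (c xs)) x)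
        rw [har]
        congr 1
        apply hinj
        ext a
        rw [hc, hbox ν _ a (c xs (m x a))]
        · rfl
        · ext b
          rw [hc, hma]
          exact (hc _ _ _).symm
      · unfold wstarT
        refine continuous_iInf_rng.2 fun p => continuous_iInf_rng.2 fun hp =>
          continuous_induced_rng.2 ?_
        have hs : Summable fun n => c (p.1 n) (p.2 n) :=
          Summable.of_norm_bounded hp fun n => hcn _ _
        have : ∀ μ : WeakDual ℂ S, ∑' n, (ofW μ) (c (p.1 n) (p.2 n)) =
            μ (∑' n, c (p.1 n) (p.2 n)) := fun μ => ((ofW μ).map_tsum hs).symm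
        have h2 : Continuous fun μ : WeakDual ℂ S => ∑' n, (ofW μ) (c (p.1 n) (p.2 n)) := by
          simp only [this]
          exact WeakDual.eval_continuous _
        exact h2
      · intro a
        ext xs x
        exact hc xs x a
  · intro B P _ _ _ _ _ _ _ _ j η' _ _ _ _ _ _ hdense Γ hΓn _ hΓc hΓη
    -- weak-star continuous functionals attached to representations
    have hF : ∀ (xs : ℕ → (X →L[ℂ] ℂ)) (x : ℕ → X), (Summable fun n => ‖xs n‖ * ‖x n‖) →
        Continuous fun μ : WeakDual ℂ P => ∑' n, Γ (j.symm (ofW μ)) (xs n) (x n) := by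
      intro xs x h
      exact @Continuous.comp _ _ _ _ (wstarT X) _ _ _ (wstar_eval xs x h) hΓc
    have hFη : ∀ (xs : ℕ → (X →L[ℂ] ℂ)) (x : ℕ → X) (s : S),
        (∀ a : A, HasSum (fun n => xs n (m (x n) a)) (ιS s a)) → ∀ a,
        ∑' n, Γ (η' a) (xs n) (x n) = ιS s a := by
      intro xs x s h a
      rw [hΓη]
      exact (h a).tsum_eq
    have hext : ∀ F G : B → ℂ, (Continuous fun μ : WeakDual ℂ P => F (j.symm (ofW μ))) →
        (Continuous fun μ : WeakDual ℂ P => G (j.symm (ofW μ))) →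
        (∀ a, F (η' a) = G (η' a)) → ∀ b, F b = G b := by
      intro F G hF hG h b
      have hid : ∀ b : B, j.symm (ofW (toW (j b))) = b := fun b => j.symm_apply_apply b
      have := hdense.equalizer hF hG (by
        funext a
        simp only [Function.comp, hid]
        exact h a)
      have h2 := congrFun this (toW (j b))
      simpa only [hid] using h2
    have hrep := fun s => exists_rep m ιS hrange hnormS s 1 one_pos
    choose xs x hsum hval _ using hrep
    have hbd : ∀ b s, ‖∑' n, Γ b (xs s n) (x s n)‖ ≤ ‖b‖ * ‖s‖ := by
      intro b s
      have key : ∀ ε : ℝ, 0 < ε → ‖∑' n, Γ b (xs s n) (x s n)‖ ≤ ‖b‖ * (‖s‖ + ε) := by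
        intro ε hε
        obtain ⟨ys, y, h1, h2, h3⟩ := exists_rep m ιS hrange hnormS s ε hε
        rw [hext (fun b => ∑' n, Γ b (xs s n) (x s n)) (fun b => ∑' n, Γ b (ys n) (y n))
          (hF _ _ (hsum s)) (hF _ _ h1)
          (fun a => by rw [hFη _ _ s (hval s), hFη _ _ s h2]) b]
        refine (summable_apply (Γ b) ys y h1).2.trans ?_
        exact mul_le_mul (hΓn b) h3.le (tsum_nonneg fun n => by positivity) (norm_nonneg _)
      have ht : Tendsto (fun ε : ℝ => ‖b‖ * (‖s‖ + ε)) (𝓝[>] 0) (𝓝 (‖b‖ * (‖s‖ + 0))) := by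
        apply Tendsto.mono_left _ nhdsWithin_le_nhds
        exact Continuous.tendsto (by fun_prop) 0
      rw [add_zero] at ht
      exact ge_of_tendsto ht (eventually_nhdsWithin_of_forall key)
    let Φ : B →ₗ[ℂ] (S →L[ℂ] ℂ) :=
      { toFun := fun b => LinearMap.mkContinuous
          { toFun := fun s => ∑' n, Γ b (xs s n) (x s n)
            map_add' := fun s t => hext (fun b => ∑' n, Γ b (xs (s + t) n) (x (s + t) n))
              (fun b => ∑' n, Γ b (xs s n) (x s n) + ∑' n, Γ b (xs t n) (x t n))
              (hF _ _ (hsum _)) ((hF _ _ (hsum _)).add (hF _ _ (hsum _)))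
              (fun a => by
                simp only [hFη _ _ _ (hval _)]
                simp) b
            map_smul' := fun k s => hext (fun b => ∑' n, Γ b (xs (k • s) n) (x (k • s) n))
              (fun b => k • ∑' n, Γ b (xs s n) (x s n))
              (hF _ _ (hsum _)) ((hF _ _ (hsum _)).const_smul k)
              (fun a => by
                simp only [hFη _ _ _ (hval _)]
                simp) b } ‖b‖ (hbd b)
        map_add' := fun b b' => by
          ext s
          change ∑' n, Γ (b + b') (xs s n) (x s n) =
            ∑' n, Γ b (xs s n) (x s n) + ∑' n, Γ b' (xs s n) (x s n)
          rw [← (summable_apply (Γ b) _ _ (hsum s)).1.tsum_add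
            (summable_apply (Γ b') _ _ (hsum s)).1]
          simp
        map_smul' := fun k b => by
          ext s
          change ∑' n, Γ (k • b) (xs s n) (x s n) = k * ∑' n, Γ b (xs s n) (x s n)
          rw [← tsum_mul_left]
          simp }
    refine ⟨Φ, ?_, ?_, ?_⟩
    · intro b
      exact LinearMap.mkContinuous_norm_le _ (norm_nonneg b) (hbd b)
    · exact WeakDual.continuous_of_continuous_eval fun s => hF _ _ (hsum s)
    · intro a
      ext s
      exact hFη _ _ s (hval s) a

end
end

section
/- Let A be a complex Banach algebra, X a complex Banach space, and (𝔄, η) an HLDBA over A for which there exists an isometric algebra homomorphism Γ : 𝔄 → B(X*), continuous from the weak* topology of 𝔄 to the weak* topology of B(X*), such that for every a ∈ A the operator Γ(η(a)) ∈ B(X*) is continuous from the weak* topology of X* to itself. Then there exists a contractive right Banach A-module action q : X × A → X, (x, a) ↦ x·a, such that ⟨Γ(η(a))(x*), x⟩ = ⟨x*, x·a⟩ for all a ∈ A, x* ∈ X*, x ∈ X, and (𝔄, η) ≅ (F_q(A*)*, η_q), where F_q(A*) is the Fourier space of this module action. -/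
open scoped Topology
open Filter

noncomputable section

/-- A weak-star continuous functional on the dual is an evaluation. -/
theorem aux_eval {S : Type*} [NormedAddCommGroup S] [NormedSpace ℂ S]
    (f : (S →L[ℂ] ℂ) →ₗ[ℂ] ℂ)
    (hf : Continuous fun μ : WeakDual ℂ S => f (ofW μ)) :
    ∃ p : S, ∀ μ : S →L[ℂ] ℂ, f μ = μ p := by
  let F : StrongDual ℂ (WeakBilin (topDualPairing ℂ S)) :=
    { toFun := fun μ => f (ofW μ)
      map_add' := fun a b => f.map_add a b
      map_smul' := fun c a => f.map_smul c a
      cont := hf }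
  obtain ⟨p, hp⟩ := LinearMap.dualEmbedding_surjective (topDualPairing ℂ S) F
  refine ⟨p, fun μ => ?_⟩
  have := congrArg (fun (L : StrongDual ℂ (WeakBilin (topDualPairing ℂ S))) => L (toW μ)) hp
  exact this.symm

/-- `p` is represented by sequences with total mass `c`. -/
def RepBy {X P : Type*} [NormedAddCommGroup X] [NormedSpace ℂ X]
    [NormedAddCommGroup P] [NormedSpace ℂ P]
    (G : (P →L[ℂ] ℂ) →ₗ[ℂ] ((X →L[ℂ] ℂ) →L[ℂ] (X →L[ℂ] ℂ))) (p : P) (c : ℝ) : Prop :=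
  ∃ (xs : ℕ → (X →L[ℂ] ℂ)) (x : ℕ → X),
    HasSum (fun n => ‖xs n‖ * ‖x n‖) c ∧
    ∀ μ : P →L[ℂ] ℂ, HasSum (fun n => G μ (xs n) (x n)) (μ p)

section rep
variable {X P : Type*} [NormedAddCommGroup X] [NormedSpace ℂ X]
    [NormedAddCommGroup P] [NormedSpace ℂ P]
    {G : (P →L[ℂ] ℂ) →ₗ[ℂ] ((X →L[ℂ] ℂ) →L[ℂ] (X →L[ℂ] ℂ))}

theorem pair_bound (μ : P →L[ℂ] ℂ) (xs : X →L[ℂ] ℂ) (x : X) :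
    ‖G μ xs x‖ ≤ ‖G μ‖ * (‖xs‖ * ‖x‖) := by
  calc ‖G μ xs x‖ ≤ ‖G μ xs‖ * ‖x‖ := (G μ xs).le_opNorm x
    _ ≤ (‖G μ‖ * ‖xs‖) * ‖x‖ := by gcongr; exact (G μ).le_opNorm xs
    _ = _ := by ring

theorem RepBy.tsum {q : ℕ → P} {c : ℕ → ℝ} {p : P} {d : ℝ}
    (h : ∀ k, RepBy G (q k) (c k)) (hc : HasSum c d)
    (hq : ∀ μ : P →L[ℂ] ℂ, HasSum (fun k => μ (q k)) (μ p)) : RepBy G p d := by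
  choose xs x h1 h2 using h
  let e : ℕ ≃ ℕ × ℕ := Nat.pairEquiv.symm
  have hs : Summable (fun z : ℕ × ℕ => ‖xs z.1 z.2‖ * ‖x z.1 z.2‖) := by
    rw [summable_prod_of_nonneg (fun z => by positivity)]
    refine ⟨fun k => (h1 k).summable, ?_⟩
    have : (fun k => ∑' y, ‖xs k y‖ * ‖x k y‖) = c := funext fun k => (h1 k).tsum_eq
    simpa [this] using hc.summable
  refine ⟨fun n => xs (e n).1 (e n).2, fun n => x (e n).1 (e n).2, ?_, fun μ => ?_⟩
  · have h3 : HasSum (fun z : ℕ × ℕ => ‖xs z.1 z.2‖ * ‖x z.1 z.2‖) d := by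
      have := hs.hasSum.prod_fiberwise h1
      rw [← this.unique hc]; exact hs.hasSum
    exact (e.hasSum_iff (f := fun z : ℕ × ℕ => ‖xs z.1 z.2‖ * ‖x z.1 z.2‖)).2 h3
  · have hs2 : Summable (fun z : ℕ × ℕ => G μ (xs z.1 z.2) (x z.1 z.2)) :=
      Summable.of_norm_bounded (hs.mul_left ‖G μ‖) (fun z => pair_bound μ _ _)
    have h3 : HasSum (fun z : ℕ × ℕ => G μ (xs z.1 z.2) (x z.1 z.2)) (μ p) := by
      have := hs2.hasSum.prod_fiberwise (fun k => h2 k μ)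
      rw [← this.unique (hq μ)]; exact hs2.hasSum
    exact (e.hasSum_iff (f := fun z : ℕ × ℕ => G μ (xs z.1 z.2) (x z.1 z.2))).2 h3

theorem RepBy.zero : RepBy G 0 0 :=
  ⟨fun _ => 0, fun _ => 0, by simp, fun μ => by simp⟩

theorem RepBy.nonneg {p : P} {c : ℝ} (h : RepBy G p c) : 0 ≤ c := by
  obtain ⟨xs, x, h1, -⟩ := h
  exact h1.nonneg (fun n => by positivity)

theorem RepBy.add {p p' : P} {c c' : ℝ} (h : RepBy G p c) (h' : RepBy G p' c') :
    RepBy G (p + p') (c + c') := by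
  let q : ℕ → P := fun k => if k = 0 then p else if k = 1 then p' else 0
  let d : ℕ → ℝ := fun k => if k = 0 then c else if k = 1 then c' else 0
  refine RepBy.tsum (q := q) (c := d) (fun k => ?_) ?_ (fun μ => ?_)
  · by_cases h0 : k = 0
    · simpa [q, d, h0] using h
    · by_cases h1 : k = 1
      · simpa [q, d, h1] using h'
      · simpa [q, d, h0, h1] using RepBy.zero
  · have := hasSum_sum_of_ne_finset_zero (L := SummationFilter.unconditional ℕ) (f := d) (s := Finset.range 2) (fun b hb => by
      have h0 : b ≠ 0 := by rintro rfl; simp at hb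
      have h1 : b ≠ 1 := by rintro rfl; simp at hb
      simp [d, h0, h1])
    simpa [Finset.sum_range_succ, d] using this
  · have := hasSum_sum_of_ne_finset_zero (L := SummationFilter.unconditional ℕ) (f := fun k => μ (q k)) (s := Finset.range 2)
      (fun b hb => by
      have h0 : b ≠ 0 := by rintro rfl; simp at hb
      have h1 : b ≠ 1 := by rintro rfl; simp at hb
      simp [q, h0, h1])
    simpa [Finset.sum_range_succ, q] using this

theorem RepBy.smul {p : P} {c : ℝ} (h : RepBy G p c) (t : ℝ) (ht : 0 ≤ t) :
    RepBy G (t • p) (t * c) := by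
  obtain ⟨xs, x, h1, h2⟩ := h
  refine ⟨fun n => (t : ℂ) • xs n, x, ?_, fun μ => ?_⟩
  · have := h1.mul_left t
    refine this.congr_fun ?_
    intro n
    simp [norm_smul, abs_of_nonneg ht, mul_assoc]
  · have := (h2 μ).mul_left (t : ℂ)
    have e : μ (t • p) = (t : ℂ) * μ p := by
      rw [← Complex.coe_smul]; simp
    rw [e]
    simpa using this

theorem RepBy.closure (hG : ∀ μ, ‖G μ‖ = ‖μ‖)
    (hex : ∀ (xs : X →L[ℂ] ℂ) (x : X), ∃ p : P, ∀ μ : P →L[ℂ] ℂ, μ p = G μ xs x)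
    (p : P) : p ∈ _root_.closure {q : P | ∃ c, c ≤ ‖p‖ ∧ RepBy G q c} := by
  by_contra hp
  set D := {q : P | ∃ c, c ≤ ‖p‖ ∧ RepBy G q c} with hD
  have hconv : Convex ℝ D := by
    rintro a ⟨c, hc, ha⟩ b ⟨d, hd, hb⟩ s t hs ht hst
    refine ⟨s * c + t * d, ?_, (ha.smul s hs).add (hb.smul t ht)⟩
    calc s * c + t * d ≤ s * ‖p‖ + t * ‖p‖ := by gcongr
      _ = ‖p‖ := by rw [← add_mul, hst, one_mul]
  have h0 : (0 : P) ∈ D := ⟨0, norm_nonneg _, RepBy.zero⟩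
  obtain ⟨f, u, hf, hu⟩ := RCLike.geometric_hahn_banach_closed_point (𝕜 := ℂ)
    hconv.closure isClosed_closure hp
  have hf' : ∀ q ∈ D, RCLike.re (f q) < u := fun q hq => hf q (subset_closure hq)
  have hu0 : 0 < u := by simpa using hf' 0 h0
  have hp0 : 0 < ‖p‖ := by
    rw [norm_pos_iff]; rintro rfl
    simp at hu; linarith
  have key : ∀ (xs : X →L[ℂ] ℂ) (x : X), ‖G f xs x‖ ≤ u / ‖p‖ * ‖xs‖ * ‖x‖ := by
    intro xs x
    by_cases hz : ‖xs‖ * ‖x‖ = 0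
    · have := pair_bound (G := G) f xs x
      rw [hz] at this
      rw [mul_assoc, hz]; simpa using this
    have hpos : 0 < ‖xs‖ * ‖x‖ := lt_of_le_of_ne (by positivity) (Ne.symm hz)
    obtain ⟨θ, hθ, hθ2⟩ : ∃ θ : ℂ, ‖θ‖ ≤ 1 ∧ θ * G f xs x = (‖G f xs x‖ : ℂ) := by
      by_cases hg : G f xs x = 0
      · exact ⟨0, by simp, by simp [hg]⟩
      · refine ⟨‖G f xs x‖ / G f xs x, ?_, div_mul_cancel₀ _ hg⟩
        rw [norm_div]; simp
        rw [div_self (norm_ne_zero_iff.2 hg)]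
    let t : ℝ := ‖p‖ / (‖xs‖ * ‖x‖)
    have ht : 0 < t := by positivity
    obtain ⟨q, hq⟩ := hex ((θ * t) • xs) x
    have hqD : q ∈ D := by
      refine ⟨‖(θ * t) • xs‖ * ‖x‖, ?_, fun n => if n = 0 then (θ * t) • xs else 0,
        fun _ => x, ?_, fun μ => ?_⟩
      · rw [norm_smul, norm_mul, Complex.norm_real, Real.norm_of_nonneg ht.le]
        calc ‖θ‖ * t * ‖xs‖ * ‖x‖ ≤ 1 * t * ‖xs‖ * ‖x‖ := by gcongr
          _ = t * (‖xs‖ * ‖x‖) := by ring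
          _ = ‖p‖ := div_mul_cancel₀ _ hz
      · convert hasSum_ite_eq 0 (‖(θ * t) • xs‖ * ‖x‖) using 2 with n
        by_cases hn : n = 0 <;> simp [hn]
      · rw [hq]
        convert hasSum_ite_eq 0 (G μ ((θ * t) • xs) x) using 2 with n
        by_cases hn : n = 0 <;> simp [hn]
    have h1 := hf' q hqD
    have h2 : f q = ((t * ‖G f xs x‖ : ℝ) : ℂ) := by
      rw [hq, map_smul]
      simp only [smul_apply, smul_eq_mul]
      push_cast
      rw [← hθ2]; ring
    rw [h2] at h1
    have h3 : t * ‖G f xs x‖ < u := by simpa using h1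
    have h4 : ‖G f xs x‖ ≤ u / t := by rw [le_div_iff₀ ht]; linarith
    calc ‖G f xs x‖ ≤ u / t := h4
      _ = u / ‖p‖ * ‖xs‖ * ‖x‖ := by simp only [t]; field_simp
  have hn : ‖f‖ ≤ u / ‖p‖ := by
    rw [← hG]
    refine ContinuousLinearMap.opNorm_le_bound _ (by positivity) fun xs => ?_
    exact ContinuousLinearMap.opNorm_le_bound _ (by positivity) fun x => key xs x
  have h5 : RCLike.re (f p) ≤ u := by
    calc RCLike.re (f p) ≤ ‖f p‖ := RCLike.re_le_norm _
      _ ≤ ‖f‖ * ‖p‖ := f.le_opNorm p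
      _ ≤ u / ‖p‖ * ‖p‖ := by gcongr
      _ = u := div_mul_cancel₀ _ hp0.ne'
  linarith

theorem RepBy.exists_le (hG : ∀ μ, ‖G μ‖ = ‖μ‖)
    (hex : ∀ (xs : X →L[ℂ] ℂ) (x : X), ∃ p : P, ∀ μ : P →L[ℂ] ℂ, μ p = G μ xs x)
    (p : P) (ε : ℝ) (hε : 0 < ε) : ∃ c, c ≤ ‖p‖ + ε ∧ RepBy G p c := by
  have step : ∀ (r : P) (k : ℕ), ∃ q : P, ∃ c, c ≤ ‖r‖ ∧ RepBy G q c ∧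
      ‖r - q‖ ≤ ε / 2 / 2 ^ k := by
    intro r k
    obtain ⟨q, ⟨c, hc, hq⟩, hd⟩ := Metric.mem_closure_iff.1 (RepBy.closure hG hex r)
      (ε / 2 / 2 ^ k) (by positivity)
    exact ⟨q, c, hc, hq, by rw [← dist_eq_norm]; exact hd.le⟩
  choose F C hC hF hR using step
  let r : ℕ → P := fun n => Nat.rec p (fun k s => s - F s k) n
  have r0 : r 0 = p := rfl
  have rs : ∀ k, r (k + 1) = r k - F (r k) k := fun k => rfl
  have rb : ∀ k, ‖r (k + 1)‖ ≤ ε / 2 / 2 ^ k := fun k => by rw [rs]; exact hR _ _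
  have hgeo : HasSum (fun k => ε / 2 / 2 ^ k : ℕ → ℝ) ε := hasSum_geometric_two' ε
  have hrs1 : Summable (fun k => ‖r (k + 1)‖) :=
    Summable.of_nonneg_of_le (fun k => norm_nonneg _) rb hgeo.summable
  have hrs : Summable (fun k => ‖r k‖) := (summable_nat_add_iff 1).1 hrs1
  have hrt : ∑' k, ‖r k‖ ≤ ‖p‖ + ε := by
    rw [hrs.tsum_eq_zero_add, r0]
    have := hrs1.tsum_le_tsum rb hgeo.summable
    rw [hgeo.tsum_eq] at this
    linarith
  have hcs : Summable (fun k => C (r k) k) :=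
    Summable.of_nonneg_of_le (fun k => (hF (r k) k).nonneg) (fun k => hC _ _) hrs
  refine ⟨∑' k, C (r k) k, (hcs.tsum_le_tsum (fun k => hC _ _) hrs).trans hrt,
    RepBy.tsum (fun k => hF (r k) k) hcs.hasSum fun μ => ?_⟩
  have hq : ∀ k, F (r k) k = r k - r (k + 1) := fun k => by rw [rs]; abel
  have hsum : Summable (fun k => μ (F (r k) k)) := by
    refine Summable.of_norm_bounded ((hrs.add hrs1).mul_left ‖μ‖) fun k => ?_
    refine (μ.le_opNorm _).trans ?_
    gcongr
    rw [hq]; exact norm_sub_le _ _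
  rw [hsum.hasSum_iff_tendsto_nat]
  have hpart : ∀ n, ∑ k ∈ Finset.range n, μ (F (r k) k) = μ p - μ (r n) := by
    intro n
    induction n with
    | zero => simp [r0]
    | succ n ih => rw [Finset.sum_range_succ, ih, hq, map_sub]; ring
  simp only [hpart]
  have hr0 : Tendsto r atTop (𝓝 0) :=
    tendsto_zero_iff_norm_tendsto_zero.2 hrs.tendsto_atTop_zero
  have := (μ.continuous.tendsto 0).comp hr0
  simpa using (tendsto_const_nhds (x := μ p)).sub this

theorem RepBy.norm_le (hG : ∀ μ, ‖G μ‖ = ‖μ‖) {p : P} {c : ℝ} (h : RepBy G p c) :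
    ‖p‖ ≤ c := by
  obtain ⟨xs, x, h1, h2⟩ := h
  have hc : 0 ≤ c := h1.nonneg (fun n => by positivity)
  refine NormedSpace.norm_le_dual_bound ℂ p hc fun μ => ?_
  rw [← (h2 μ).tsum_eq, mul_comm, ← hG, ← (h1.mul_left ‖G μ‖).tsum_eq]
  exact tsum_of_norm_bounded (h1.mul_left ‖G μ‖).summable.hasSum fun n => pair_bound μ _ _

end rep

/-- Let `(B, η)` be an HLDBA over `A` (predual `P`, identification
`j`) with an isometric weak-star continuous algebra representation `Γ : B → B(X*)`
such that each `Γ(η a)` is weak-star continuous on `X*`.  Then there is a contractive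
right Banach `A`-module action `m` on `X` with `⟨Γ(η a) x*, x⟩ = ⟨x*, x·a⟩`, and
`(B, η) ≅ (F_q(A*)*, η_q)`: via `j`, the predual `P` is realized isometrically as the
Fourier space `(F_q(A*), ‖·‖_q)` by an embedding `ι`, under which multiplication in
`B` becomes the first Arens product and `η` becomes `η_q`. -/
theorem statement_11
    {A : Type*} [NonUnitalNormedRing A] [NormedSpace ℂ A] [CompleteSpace A]
    [IsScalarTower ℂ A A] [SMulCommClass ℂ A A]
    {X : Type*} [NormedAddCommGroup X] [NormedSpace ℂ X] [CompleteSpace X]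
    {B : Type*} [NonUnitalNormedRing B] [NormedSpace ℂ B] [CompleteSpace B]
    [IsScalarTower ℂ B B] [SMulCommClass ℂ B B]
    {P : Type*} [NormedAddCommGroup P] [NormedSpace ℂ P] [CompleteSpace P]
    (j : B ≃ₗᵢ[ℂ] (P →L[ℂ] ℂ))
    (hw : ∀ ν : B, Continuous fun μ : WeakDual ℂ P => toW (j (j.symm (ofW μ) * ν)))
    (η : A → B)
    (hadd : ∀ a b, η (a + b) = η a + η b)
    (hsmul : ∀ (c : ℂ) a, η (c • a) = c • η a)
    (hmul : ∀ a b, η (a * b) = η a * η b)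
    (hnorm : ∀ a, ‖η a‖ ≤ ‖a‖)
    (hZt : ∀ a : A, Continuous fun ν : WeakDual ℂ P => toW (j (η a * j.symm (ofW ν))))
    (hdense : DenseRange fun a : A => toW (j (η a)))
    (Γ : B →ₗ[ℂ] ((X →L[ℂ] ℂ) →L[ℂ] (X →L[ℂ] ℂ)))
    (hΓiso : ∀ b, ‖Γ b‖ = ‖b‖)
    (hΓmul : ∀ b b', Γ (b * b') = (Γ b).comp (Γ b'))
    (hΓw : @Continuous (WeakDual ℂ P) _ _ (wstarT X) (fun μ => Γ (j.symm (ofW μ))))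
    (hΓσ : ∀ a : A, Continuous fun xs : WeakDual ℂ X => toW ((Γ (η a)) (ofW xs))) :
    ∃ m : X →L[ℂ] A →L[ℂ] X,
      (∀ (x : X) (a : A), ‖m x a‖ ≤ ‖x‖ * ‖a‖) ∧
      (∀ (x : X) (a b : A), m (m x a) b = m x (a * b)) ∧
      (∀ (a : A) (xs : X →L[ℂ] ℂ) (x : X), Γ (η a) xs x = xs (m x a)) ∧
      ∃ (ι : P →ₗ[ℂ] (A →L[ℂ] ℂ)) (box : B → P → P),
        Function.Injective ι ∧
        (∀ φ, FqMem m φ ↔ φ ∈ Set.range ι) ∧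
        (∀ ψ : P, ‖ψ‖ = qNorm m (ι ψ)) ∧
        (∀ (s : P) (a : A), ∃ u : P, ι u = dAct (ι s) a) ∧
        (∀ (ν : B) (s : P) (a : A) (u : P),
          ι u = dAct (ι s) a → ι (box ν s) a = j ν u) ∧
        (∀ (μ ν : B) (s : P), j (μ * ν) s = j μ (box ν s)) ∧
        (∀ (a : A) (s : P), j (η a) s = ι s a) := by
  -- the module action
  have hadj : ∀ (x : X) (a : A), ∃ y : X, ∀ xs : X →L[ℂ] ℂ, Γ (η a) xs x = xs y := by
    intro x a
    refine aux_eval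
      { toFun := fun xs => Γ (η a) xs x
        map_add' := fun u v => by simp
        map_smul' := fun c u => by simp } ?_
    exact (WeakDual.eval_continuous x).comp (hΓσ a)
  choose m₀ hm₀ using hadj
  have hsep : ∀ y z : X, (∀ xs : X →L[ℂ] ℂ, xs y = xs z) → y = z := fun y z h =>
    (SeparatingDual.eq_iff_forall_dual_eq (R := ℂ)).2 h
  have hsepP : ∀ y z : P, (∀ xs : P →L[ℂ] ℂ, xs y = xs z) → y = z := fun y z h =>
    (SeparatingDual.eq_iff_forall_dual_eq (R := ℂ)).2 h
  have hm_norm : ∀ x a, ‖m₀ x a‖ ≤ 1 * ‖x‖ * ‖a‖ := by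
    intro x a
    refine NormedSpace.norm_le_dual_bound ℂ _ (by positivity) fun xs => ?_
    rw [← hm₀]
    calc ‖Γ (η a) xs x‖ ≤ ‖Γ (η a) xs‖ * ‖x‖ := (Γ (η a) xs).le_opNorm x
      _ ≤ (‖Γ (η a)‖ * ‖xs‖) * ‖x‖ := by gcongr; exact (Γ (η a)).le_opNorm xs
      _ ≤ (‖a‖ * ‖xs‖) * ‖x‖ := by gcongr; rw [hΓiso]; exact hnorm a
      _ = 1 * ‖x‖ * ‖a‖ * ‖xs‖ := by ring
  let m : X →L[ℂ] A →L[ℂ] X := LinearMap.mkContinuous₂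
    (LinearMap.mk₂ ℂ m₀
      (fun x y a => hsep _ _ fun xs => by simp [← hm₀])
      (fun c x a => hsep _ _ fun xs => by simp [← hm₀])
      (fun x a b => hsep _ _ fun xs => by simp [← hm₀, hadd])
      (fun c x a => hsep _ _ fun xs => by simp [← hm₀, hsmul])) 1 hm_norm
  have hm : ∀ (a : A) (xs : X →L[ℂ] ℂ) (x : X), Γ (η a) xs x = xs (m x a) :=
    fun a xs x => hm₀ x a xs
  -- the embedding of the predual
  let ι : P →ₗ[ℂ] (A →L[ℂ] ℂ) :=
    { toFun := fun s => LinearMap.mkContinuous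
        { toFun := fun a => j (η a) s
          map_add' := fun a b => by simp [hadd]
          map_smul' := fun c a => by simp [hsmul] } ‖s‖ (fun a => by
            calc ‖j (η a) s‖ ≤ ‖j (η a)‖ * ‖s‖ := (j (η a)).le_opNorm s
              _ ≤ ‖a‖ * ‖s‖ := by gcongr; rw [j.norm_map]; exact hnorm a
              _ = ‖s‖ * ‖a‖ := mul_comm _ _)
      map_add' := fun s t => by ext a; simp
      map_smul' := fun c s => by ext a; simp }
  have hι : ∀ s a, ι s a = j (η a) s := fun s a => rfl
  have hinj : Function.Injective ι := by
    intro s t hst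
    refine hsepP _ _ fun μ => ?_
    have hc := hdense.equalizer (WeakDual.eval_continuous s) (WeakDual.eval_continuous t)
      (funext fun a => by
        have := congrArg (fun φ : A →L[ℂ] ℂ => φ a) hst
        exact this)
    exact congrFun hc (toW μ)
  -- box
  have hbox : ∀ (ν : B) (s : P), ∃ p : P, ∀ μ : P →L[ℂ] ℂ, j (j.symm μ * ν) s = μ p := by
    intro ν s
    refine aux_eval
      { toFun := fun μ => j (j.symm μ * ν) s
        map_add' := fun u v => by simp [add_mul]
        map_smul' := fun c u => by simp [smul_mul_assoc] } ?_
    exact (WeakDual.eval_continuous s).comp (hw ν)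
  choose box hbox using hbox
  have hact : ∀ (s : P) (a : A), ∃ p : P, ∀ μ : P →L[ℂ] ℂ, j (η a * j.symm μ) s = μ p := by
    intro s a
    refine aux_eval
      { toFun := fun μ => j (η a * j.symm μ) s
        map_add' := fun u v => by simp [mul_add]
        map_smul' := fun c u => by simp [mul_smul_comm] } ?_
    exact (WeakDual.eval_continuous s).comp (hZt a)
  choose act hact using hact
  have hact2 : ∀ s a, ι (act s a) = dAct (ι s) a := by
    intro s a
    ext b
    have := hact s a (j (η b))
    rw [j.symm_apply_apply, ← hmul] at this
    exact this.symm
  -- the representation transported to `P*`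
  let G : (P →L[ℂ] ℂ) →ₗ[ℂ] ((X →L[ℂ] ℂ) →L[ℂ] (X →L[ℂ] ℂ)) :=
    Γ.comp j.symm.toLinearEquiv.toLinearMap
  have hGa : ∀ μ, G μ = Γ (j.symm μ) := fun μ => rfl
  have hG : ∀ μ, ‖G μ‖ = ‖μ‖ := fun μ => by rw [hGa, hΓiso, j.symm.norm_map]
  have hsummG : ∀ (xs : ℕ → (X →L[ℂ] ℂ)) (x : ℕ → X), (Summable fun n => ‖xs n‖ * ‖x n‖) →
      ∀ μ, Summable fun n => G μ (xs n) (x n) := fun xs x hs μ =>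
    Summable.of_norm_bounded (hs.mul_left ‖G μ‖) (fun n => pair_bound μ _ _)
  have hrep : ∀ (xs : ℕ → (X →L[ℂ] ℂ)) (x : ℕ → X), (Summable fun n => ‖xs n‖ * ‖x n‖) →
      ∃ p : P, ∀ μ : P →L[ℂ] ℂ, HasSum (fun n => G μ (xs n) (x n)) (μ p) := by
    intro xs x hs
    obtain ⟨p, hp⟩ := aux_eval
      { toFun := fun μ => ∑' n, G μ (xs n) (x n)
        map_add' := fun u v => by
          rw [← (hsummG xs x hs u).tsum_add (hsummG xs x hs v)]; simp
        map_smul' := fun c u => by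
          simp only [RingHom.id_apply, smul_eq_mul]
          rw [← tsum_mul_left]; simp } (by
        have h1 := continuous_iInf_rng.1 hΓw (xs, x)
        have h2 := continuous_iInf_rng.1 h1 hs
        exact (continuous_induced_rng (g := fun μ : WeakDual ℂ P => Γ (j.symm (ofW μ)))
          (f := fun T : (X →L[ℂ] ℂ) →L[ℂ] (X →L[ℂ] ℂ) => ∑' n, T (xs n) (x n))).1 h2)
    refine ⟨p, fun μ => ?_⟩
    rw [← hp]
    exact (hsummG xs x hs μ).hasSum
  have hex : ∀ (xs : X →L[ℂ] ℂ) (x : X), ∃ p : P, ∀ μ : P →L[ℂ] ℂ, μ p = G μ xs x := by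
    intro xs x
    obtain ⟨p, hp⟩ := hrep (fun n => if n = 0 then xs else 0) (fun _ => x)
      (summable_of_ne_finset_zero (s := {0}) (fun n hn => by
        have hn : n ≠ 0 := by simpa using hn
        simp [hn]))
    refine ⟨p, fun μ => ?_⟩
    have h1 := hasSum_single (f := fun n : ℕ => G μ (if n = 0 then xs else 0) x) 0
      (fun n hn => by simp [hn])
    have := (hp μ).unique h1
    simpa using this
  have hfrom : ∀ (φ : A →L[ℂ] ℂ) (xs : ℕ → (X →L[ℂ] ℂ)) (x : ℕ → X),
      (Summable fun n => ‖xs n‖ * ‖x n‖) →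
      (∀ a : A, HasSum (fun n => xs n (m (x n) a)) (φ a)) →
      ∃ p, ι p = φ ∧ RepBy G p (∑' n, ‖xs n‖ * ‖x n‖) := by
    intro φ xs x hs hφ
    obtain ⟨p, hp⟩ := hrep xs x hs
    refine ⟨p, ?_, xs, x, hs.hasSum, hp⟩
    ext a
    refine (hp (j (η a))).unique ?_
    simp only [hGa, j.symm_apply_apply, hm]
    exact hφ a
  have hto : ∀ (p : P) (c : ℝ), RepBy G p c → ∃ (xs : ℕ → (X →L[ℂ] ℂ)) (x : ℕ → X),
      (Summable fun n => ‖xs n‖ * ‖x n‖) ∧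
      (∀ a : A, HasSum (fun n => xs n (m (x n) a)) (ι p a)) ∧
      c = ∑' n, ‖xs n‖ * ‖x n‖ := by
    rintro p c ⟨xs, x, h1, h2⟩
    refine ⟨xs, x, h1.summable, fun a => ?_, h1.tsum_eq.symm⟩
    have := h2 (j (η a))
    simp only [hGa, j.symm_apply_apply, hm] at this
    exact this
  refine ⟨m, fun x a => (hm_norm x a).trans_eq (by ring), ?_, hm, ι, box, hinj, ?_, ?_, ?_, ?_, ?_, ?_⟩
  · intro x a b
    refine hsep _ _ fun xs => ?_
    rw [← hm, ← hm, ← hm, hmul, hΓmul]; rfl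
  · intro φ
    constructor
    · rintro ⟨xs, x, hs, hφ⟩
      obtain ⟨p, hp, -⟩ := hfrom φ xs x hs hφ
      exact ⟨p, hp⟩
    · rintro ⟨p, rfl⟩
      obtain ⟨c, -, hc⟩ := RepBy.exists_le hG hex p 1 one_pos
      obtain ⟨xs, x, h1, h2, -⟩ := hto p c hc
      exact ⟨xs, x, h1, h2⟩
  · intro ψ
    have hlow : ∀ c ∈ { c : ℝ | ∃ (xs : ℕ → (X →L[ℂ] ℂ)) (x : ℕ → X),
        (Summable fun n => ‖xs n‖ * ‖x n‖) ∧
        (∀ a : A, HasSum (fun n => xs n (m (x n) a)) (ι ψ a)) ∧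
        c = ∑' n, ‖xs n‖ * ‖x n‖ }, ‖ψ‖ ≤ c := by
      rintro c ⟨xs, x, hs, hφ, rfl⟩
      obtain ⟨p, hp, hr⟩ := hfrom _ xs x hs hφ
      rw [← hinj hp]
      exact hr.norm_le hG
    apply le_antisymm
    · obtain ⟨c, -, hc⟩ := RepBy.exists_le hG hex ψ 1 one_pos
      exact le_csInf ⟨c, hto ψ c hc⟩ hlow
    · refine le_of_forall_pos_le_add fun ε hε => ?_
      obtain ⟨c, hcle, hc⟩ := RepBy.exists_le hG hex ψ ε hε
      exact (csInf_le ⟨‖ψ‖, hlow⟩ (hto ψ c hc)).trans hcle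
  · exact fun s a => ⟨act s a, hact2 s a⟩
  · intro ν s a u hu
    have : u = act s a := hinj (hu.trans (hact2 s a).symm)
    rw [this, hι, ← hbox, ← hact, j.symm_apply_apply, j.symm_apply_apply]
  · intro μ ν s
    rw [← hbox, j.symm_apply_apply]
  · exact fun a s => rfl

end
end
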